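/- Let S be a finite nonempty linearly ordered set, U uniform on [0,1], and g₁, g₂ : [0,1] → S monotone nondecreasing measurable functions with g₁(u) ≤ g₂(u) for all u (pointwise dominance). Then for any x ∈ S, P(g₁(U) = x ∧ g₂(U) = x) = max(0, min(P(g₁(U) ≤ x), P(g₂(U) ≤ x)) − max(P(g₁(U) < x), P(g₂(U) < x))) = max(0, P(g₂(U) ≤ x) − P(g₁(U) < x)). -/

import Mathlib

open MeasureTheory Set

theorem stmt_14 (S : Type*) [Fintype S] [Nonempty S] [LinearOrder S]
    [MeasurableSpace S] (g₁ g₂ : ℝ → S)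
    (hg₁ : MonotoneOn g₁ (Icc (0:ℝ) 1)) (hg₂ : MonotoneOn g₂ (Icc (0:ℝ) 1))
    (hm₁ : Measurable g₁) (hm₂ : Measurable g₂)
    (hdom : ∀ u ∈ Icc (0:ℝ) 1, g₁ u ≤ g₂ u) (x : S) :
    (volume.restrict (Icc (0:ℝ) 1)) {u | g₁ u = x ∧ g₂ u = x} =
      (min ((volume.restrict (Icc (0:ℝ) 1)) {u | g₁ u ≤ x})
           ((volume.restrict (Icc (0:ℝ) 1)) {u | g₂ u ≤ x})
        - max ((volume.restrict (Icc (0:ℝ) 1)) {u | g₁ u < x})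
              ((volume.restrict (Icc (0:ℝ) 1)) {u | g₂ u < x})) ∧
    (volume.restrict (Icc (0:ℝ) 1)) {u | g₁ u = x ∧ g₂ u = x} =
      (volume.restrict (Icc (0:ℝ) 1)) {u | g₂ u ≤ x}
        - (volume.restrict (Icc (0:ℝ) 1)) {u | g₁ u < x} := by
  have hI : MeasurableSet (Icc (0:ℝ) 1) := measurableSet_Icc
  have key : (volume.restrict (Icc (0:ℝ) 1)) {u | g₁ u = x ∧ g₂ u = x} =
      (volume.restrict (Icc (0:ℝ) 1)) {u | g₂ u ≤ x}
        - (volume.restrict (Icc (0:ℝ) 1)) {u | g₁ u < x} := by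
    simp only [Measure.restrict_apply' hI]
    have hB : MeasurableSet ({u | g₁ u < x} ∩ Icc (0:ℝ) 1) := by
      apply Set.OrdConnected.measurableSet
      refine ⟨fun a ha b hb c hc => ?_⟩
      have hcI : c ∈ Icc (0:ℝ) 1 := ⟨ha.2.1.trans hc.1, hc.2.trans hb.2.2⟩
      exact ⟨lt_of_le_of_lt (hg₁ hcI hb.2 hc.2) hb.1, hcI⟩
    have hBf : volume ({u | g₁ u < x} ∩ Icc (0:ℝ) 1) ≠ ⊤ :=
      ne_top_of_le_ne_top (by simp) (measure_mono (inter_subset_right (t := Icc (0:ℝ) 1)))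
    have hE : {u | g₁ u = x ∧ g₂ u = x} ∩ Icc (0:ℝ) 1 =
        ({u | g₂ u ≤ x} ∩ Icc (0:ℝ) 1) \ ({u | g₁ u < x} ∩ Icc (0:ℝ) 1) := by
      ext u
      constructor
      · rintro ⟨⟨h1, h2⟩, hu⟩
        exact ⟨⟨h2.le, hu⟩, fun h => absurd h.1 (not_lt.mpr h1.ge)⟩
      · rintro ⟨⟨h2, hu⟩, hn⟩
        have h1 : x ≤ g₁ u := not_lt.mp fun h => hn ⟨h, hu⟩
        have hd := hdom u hu
        exact ⟨⟨le_antisymm (hd.trans h2) h1, le_antisymm h2 (h1.trans hd)⟩, hu⟩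
    rw [hE]
    by_cases hsub : ({u | g₁ u < x} ∩ Icc (0:ℝ) 1) ⊆ ({u | g₂ u ≤ x} ∩ Icc (0:ℝ) 1)
    · exact measure_diff hsub hB.nullMeasurableSet hBf
    · have hsub' : ({u | g₂ u ≤ x} ∩ Icc (0:ℝ) 1) ⊆ ({u | g₁ u < x} ∩ Icc (0:ℝ) 1) := by
        obtain ⟨b, hb, hbA⟩ := Set.not_subset.mp hsub
        intro a ha
        have hab : a ≤ b := by
          by_contra h
          exact hbA ⟨(hg₂ hb.2 ha.2 (not_le.mp h).le).trans ha.1, hb.2⟩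
        exact ⟨lt_of_le_of_lt (hg₁ ha.2 hb.2 hab) hb.1, ha.2⟩
      rw [diff_eq_empty.mpr hsub', measure_empty, tsub_eq_zero_of_le (measure_mono hsub')]
  refine ⟨?_, key⟩
  have h1 : (volume.restrict (Icc (0:ℝ) 1)) {u | g₂ u ≤ x} ≤
      (volume.restrict (Icc (0:ℝ) 1)) {u | g₁ u ≤ x} := by
    simp only [Measure.restrict_apply' hI]
    exact measure_mono fun u hu => ⟨(hdom u hu.2).trans hu.1, hu.2⟩
  have h2 : (volume.restrict (Icc (0:ℝ) 1)) {u | g₂ u < x} ≤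
      (volume.restrict (Icc (0:ℝ) 1)) {u | g₁ u < x} := by
    simp only [Measure.restrict_apply' hI]
    exact measure_mono fun u hu => ⟨(hdom u hu.2).trans_lt hu.1, hu.2⟩
  rw [min_eq_right h1, max_eq_left h2, key]
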